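/- Let m > r be positive integers, A ∈ ℤ^{r×m} a positive and abundant matrix, and b ∈ ℤ^r such that S(A,b) ≠ ∅. Then the number of ordered pairs (x, y) of proper solutions x, y ∈ S_0(A,b) ∩ [n]^m whose entry sets intersect ({x} ∩ {y} ≠ ∅) is Θ(n^{2m − 2·rk(A) − 1}) as n → ∞; that is, there are constants c, C > 0 and n_0 such that for all n ≥ n_0 this count lies between c·n^{2m − 2 rk(A) − 1} and C·n^{2m − 2 rk(A) − 1}. -/

import Mathlib

open Matrix Finset MeasureTheory ProbabilityTheory Filter Topology
open scoped BoundedContinuousFunction NNReal ENNReal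

attribute [local instance] Classical.propDecidable

noncomputable section

/-- The rank over `ℚ` of an integer matrix. -/
def rkZ {α β : Type*} [Fintype α] [Fintype β] (A : Matrix α β ℤ) : ℕ :=
  (A.map (Int.cast : ℤ → ℚ)).rank

/-- The submatrix consisting of the columns indexed by `Q`. -/
def colSub {α β : Type*} (A : Matrix α β ℤ) (Q : Finset β) : Matrix α Q ℤ :=
  A.submatrix id (fun j => (j : β))

/-- A matrix is positive if `Ax = 0` has a solution with all entries positive and,
for every pair of distinct indices, a solution whose corresponding entries differ. -/
def IsPositiveMat {α β : Type*} [Fintype β] (A : Matrix α β ℤ) : Prop :=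
  (∃ x : β → ℤ, A.mulVec x = 0 ∧ ∀ j, 0 < x j) ∧
    ∀ i j : β, i ≠ j → ∃ x : β → ℤ, A.mulVec x = 0 ∧ x i ≠ x j

/-- A matrix is abundant if it has positive rank and removing at most two columns
does not change the rank. -/
def IsAbundantMat {α β : Type*} [Fintype α] [Fintype β] (A : Matrix α β ℤ) : Prop :=
  0 < rkZ A ∧ ∀ Q : Finset β, Fintype.card β - 2 ≤ Q.card → rkZ (colSub A Q) = rkZ A

/-- `r_Q(A) = rk(A) - rk(A^{complement of Q})`. -/
def rQ {α β : Type*} [Fintype α] [Fintype β] (A : Matrix α β ℤ) (Q : Finset β) : ℕ :=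
  rkZ A - rkZ (colSub A Qᶜ)

/-- The density `c(A) = max over nonempty Q of |Q|/(|Q| - r_Q(A))`. -/
def matDensity {α β : Type*} [Fintype α] [Fintype β] (A : Matrix α β ℤ) : ℝ :=
  sSup {x : ℝ | ∃ Q : Finset β, Q.Nonempty ∧
    x = (Q.card : ℝ) / ((Q.card : ℝ) - (rQ A Q : ℝ))}

/-- The matrix `A_𝔭` obtained by summing columns over the classes of a partition
(realised as a setoid); columns are indexed by the classes. -/
def contract {α β : Type*} [Fintype β] (A : Matrix α β ℤ) (s : Setoid β) :
    Matrix α (Quotient s) ℤ :=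
  fun i c => ∑ j ∈ Finset.univ.filter (fun j => Quotient.mk s j = c), A i j

/-- `𝔓(A)`: partitions whose contracted matrix has full rank `rk(A)`. -/
def partitionFamily {α β : Type*} [Fintype α] [Fintype β] (A : Matrix α β ℤ) :
    Set (Setoid β) :=
  {s | rkZ (contract A s) = rkZ A}

/-- The partition of `β` into singletons, as a setoid. -/
def singletonSetoid (β : Type*) : Setoid β := ⟨Eq, eq_equivalence⟩

/-- Proper solutions: solutions with pairwise distinct coordinates. -/
def properSols {α β : Type*} [Fintype β] (A : Matrix α β ℤ) (b : α → ℤ) : Set (β → ℤ) :=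
  {x | A.mulVec x = b ∧ Function.Injective x}

/-- Type-`𝔓` solutions: solutions whose induced partition (the kernel setoid) lies in `𝔓`. -/
def typeSols {α β : Type*} [Fintype β] (A : Matrix α β ℤ) (b : α → ℤ)
    (P : Set (Setoid β)) : Set (β → ℤ) :=
  {x | A.mulVec x = b ∧ Setoid.ker x ∈ P}

/-- The Bernoulli measure on `Bool` with parameter `p`. -/
def bern (p : ℝ≥0) (h : p ≤ 1) : Measure Bool :=
  (PMF.bernoulli p (by exact_mod_cast h)).toMeasure

/-- The product Bernoulli measure on `Fin n → Bool`, modelling the random set `[n]_p`. -/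
def prodBern (n : ℕ) (p : ℝ≥0) (h : p ≤ 1) : Measure (Fin n → Bool) :=
  Measure.pi fun _ => bern p h

/-- An integer `a` is a selected element of `[n]_p` in outcome `ω`. -/
def selected {n : ℕ} (ω : Fin n → Bool) (a : ℤ) : Prop :=
  ∃ i : Fin n, a = (i : ℕ) + 1 ∧ ω i = true

/-- The number of solutions in `S` whose entries all lie in the random set `[n]_p`. -/
def solCount {β : Type*} (S : Set (β → ℤ)) (n : ℕ) (ω : Fin n → Bool) : ℕ :=
  Nat.card {x : β → ℤ // x ∈ S ∧ ∀ j, selected ω (x j)}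

end

/-- Integer vectors cast to `ℚ`. -/
def cst {m : ℕ} (x : Fin m → ℤ) : Fin m → ℚ := fun j => (x j : ℚ)

theorem box_count {m n : ℕ} (hn : 1 ≤ n) : ∀ (d : ℕ) (V : Submodule ℚ (Fin m → ℚ)),
    Module.finrank ℚ V ≤ d → ∀ S : Finset (Fin m → ℤ),
    (∀ x ∈ S, ∀ j, 1 ≤ x j ∧ x j ≤ n) → (∀ x ∈ S, ∀ y ∈ S, cst (x - y) ∈ V) →
    S.card ≤ n ^ d := by
  intro d
  induction d with
  | zero =>
    intro V hV S hS hd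
    have hV0 : V = ⊥ := Submodule.finrank_eq_zero.1 (by omega)
    rw [pow_zero, Finset.card_le_one]
    intro x hx y hy
    have h := hd x hx y hy
    rw [hV0, Submodule.mem_bot] at h
    funext j
    have h2 := congrFun h j
    simp only [cst, Pi.sub_apply, Pi.zero_apply, Int.cast_eq_zero] at h2
    omega
  | succ d ih =>
    intro V hV S hS hd
    by_cases hj : ∃ j : Fin m, ∃ v ∈ V, v j ≠ 0
    · obtain ⟨j, v, hv, hvj⟩ := hj
      let W : Submodule ℚ (Fin m → ℚ) := V ⊓ LinearMap.ker (LinearMap.proj (R := ℚ) (φ := fun _ => ℚ) j)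
      have hlt : W < V := by
        refine lt_of_le_of_ne inf_le_left ?_
        intro h
        have : v ∈ W := h ▸ hv
        exact hvj (by simpa using (Submodule.mem_inf.1 this).2)
      have hW := Submodule.finrank_lt_finrank_of_lt hlt
      have key : S.card ≤ n ^ d * (Finset.Icc (1:ℤ) n).card := by
        refine Finset.card_le_mul_card_image_of_maps_to (f := fun x => x j) ?_ _ ?_
        · intro x hx
          exact Finset.mem_Icc.2 (hS x hx j)
        · intro a _
          refine ih W (by omega) _ ?_ ?_
          · intro x hx
            exact hS x (Finset.mem_filter.1 hx).1
          · intro x hx y hy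
            rw [Finset.mem_filter] at hx hy
            refine Submodule.mem_inf.2 ⟨hd x hx.1 y hy.1, ?_⟩
            simp [cst, hx.2, hy.2]
      simpa [pow_succ] using key
    · push Not at hj
      refine (Finset.card_le_one.2 ?_).trans (Nat.one_le_pow _ _ hn)
      intro x hx y hy
      funext j
      have h2 := hj j _ (hd x hx y hy)
      simp only [cst, Pi.sub_apply, Int.cast_eq_zero] at h2
      omega

/-- Kernel over `ℚ`. -/
def kerQ {r m : ℕ} (A : Matrix (Fin r) (Fin m) ℤ) : Submodule ℚ (Fin m → ℚ) :=
  LinearMap.ker (A.map (Int.cast : ℤ → ℚ)).mulVecLin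

theorem mem_kerQ {r m : ℕ} (A : Matrix (Fin r) (Fin m) ℤ) (x : Fin m → ℤ) :
    cst x ∈ kerQ A ↔ A.mulVec x = 0 := by
  have h : (A.map (Int.cast : ℤ → ℚ)).mulVec (cst x) = fun i => ((A.mulVec x i : ℤ) : ℚ) := by
    funext i
    simp [Matrix.mulVec, dotProduct, cst]
  rw [kerQ, LinearMap.mem_ker, Matrix.mulVecLin_apply, h]
  constructor
  · intro h; funext i; simpa using congrFun h i
  · intro h; funext i; simp [h]

theorem finrank_kerQ {r m : ℕ} (A : Matrix (Fin r) (Fin m) ℤ) :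
    rkZ A + Module.finrank ℚ (kerQ A) = m := by
  have := LinearMap.finrank_range_add_finrank_ker (A.map (Int.cast : ℤ → ℚ)).mulVecLin
  have h2 : Module.finrank ℚ (Fin m → ℚ) = m := by simp
  rw [h2] at this
  exact this

theorem exists_int_basis {r m : ℕ} (A : Matrix (Fin r) (Fin m) ℤ) :
    ∃ w : Fin (Module.finrank ℚ (kerQ A)) → Fin m → ℤ, (∀ i, A.mulVec (w i) = 0) ∧
      LinearIndependent ℚ (fun i => cst (w i)) := by
  let B := Module.finBasis ℚ (kerQ A)
  obtain ⟨D, hD⟩ := IsLocalization.exist_integer_multiples_of_finite (nonZeroDivisors ℤ)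
    (fun ij : Fin (Module.finrank ℚ (kerQ A)) × Fin m => ((B ij.1 : Fin m → ℚ) ij.2))
  have hD0 : ((D : ℤ) : ℚ) ≠ 0 := by
    exact_mod_cast nonZeroDivisors.coe_ne_zero D
  choose w hw using hD
  have hw' : ∀ i, cst (fun j => w (i, j)) = ((D : ℤ) : ℚ) • (B i : Fin m → ℚ) := by
    intro i
    funext j
    have := hw (i, j)
    simpa [cst, Algebra.smul_def, Submonoid.smul_def] using this
  refine ⟨fun i j => w (i, j), ?_, ?_⟩
  · intro i
    rw [← mem_kerQ, hw']
    exact Submodule.smul_mem _ _ (B i).2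
  · have h1 : LinearIndependent ℚ (fun i => (B i : Fin m → ℚ)) :=
      B.linearIndependent.map' (kerQ A).subtype (Submodule.ker_subtype _)
    have h2 := h1.units_smul (fun _ => Units.mk0 _ hD0)
    convert h2 using 1
    funext i
    rw [hw']
    rfl

/-- Solutions in the box. -/
noncomputable def solF {r m : ℕ} (A : Matrix (Fin r) (Fin m) ℤ) (b : Fin r → ℤ) (n : ℕ) :
    Finset (Fin m → ℤ) :=
  (Fintype.piFinset (fun _ => Finset.Icc (1:ℤ) n)).filter (fun x => A.mulVec x = b)

theorem mem_solF {r m : ℕ} (A : Matrix (Fin r) (Fin m) ℤ) (b : Fin r → ℤ) (n : ℕ)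
    (x : Fin m → ℤ) : x ∈ solF A b n ↔ (∀ j, 1 ≤ x j ∧ x j ≤ n) ∧ A.mulVec x = b := by
  simp [solF]

theorem sub_mem_kerQ {r m : ℕ} (A : Matrix (Fin r) (Fin m) ℤ) (b : Fin r → ℤ)
    {x y : Fin m → ℤ} (hx : A.mulVec x = b) (hy : A.mulVec y = b) : cst (x - y) ∈ kerQ A := by
  rw [mem_kerQ, Matrix.mulVec_sub, hx, hy, sub_self]

/-- Solutions satisfying a further nontrivial homogeneous difference constraint. -/
theorem restricted_count {r m n : ℕ} (hn : 1 ≤ n) (A : Matrix (Fin r) (Fin m) ℤ)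
    (b : Fin r → ℤ) (f : (Fin m → ℚ) →ₗ[ℚ] ℚ) (v : Fin m → ℤ) (hv : A.mulVec v = 0)
    (hfv : f (cst v) ≠ 0) (S : Finset (Fin m → ℤ)) (hS : S ⊆ solF A b n)
    (hf : ∀ x ∈ S, ∀ y ∈ S, f (cst (x - y)) = 0) :
    S.card ≤ n ^ (Module.finrank ℚ (kerQ A) - 1) := by
  have hlt : kerQ A ⊓ LinearMap.ker f < kerQ A := by
    refine lt_of_le_of_ne inf_le_left ?_
    intro h
    have h1 : cst v ∈ kerQ A ⊓ LinearMap.ker f := by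
      rw [h]; exact (mem_kerQ A v).2 hv
    exact hfv (by simpa using (Submodule.mem_inf.1 h1).2)
  have hW := Submodule.finrank_lt_finrank_of_lt hlt
  refine box_count hn _ (kerQ A ⊓ LinearMap.ker f) (by omega) S ?_ ?_
  · intro x hx
    exact ((mem_solF A b n x).1 (hS hx)).1
  · intro x hx y hy
    exact Submodule.mem_inf.2 ⟨sub_mem_kerQ A b ((mem_solF A b n x).1 (hS hx)).2
      ((mem_solF A b n y).1 (hS hy)).2, by simpa using hf x hx y hy⟩

/-- Lower bound for all solutions. -/
theorem sol_lower {r m : ℕ} (A : Matrix (Fin r) (Fin m) ℤ) (hApos : IsPositiveMat A)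
    (b : Fin r → ℤ) (hb : ∃ x : Fin m → ℤ, A.mulVec x = b) :
    ∃ D n₀ : ℕ, 0 < D ∧ ∀ n ≥ n₀, (n / D) ^ (Module.finrank ℚ (kerQ A)) ≤ (solF A b n).card := by
  obtain ⟨x0, hx0⟩ := hb
  obtain ⟨⟨p, hp, hp0⟩, -⟩ := hApos
  have hB := exists_int_basis A
  generalize Module.finrank ℚ (kerQ A) = k at hB ⊢
  obtain ⟨w, hw, hli⟩ := hB
  obtain ⟨L, hL0, hLx, hLp, hLw⟩ : ∃ L : ℕ, 0 < L ∧ (∀ j, |x0 j| ≤ L) ∧ (∀ j, |p j| ≤ L) ∧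
      ∀ i j, |w i j| ≤ L := by
    refine ⟨1 + ∑ j, (x0 j).natAbs + ∑ j, (p j).natAbs + ∑ i, ∑ j, (w i j).natAbs,
      by omega, ?_, ?_, ?_⟩
    · intro j
      have := Finset.single_le_sum (f := fun j => (x0 j).natAbs) (fun _ _ => Nat.zero_le _)
        (Finset.mem_univ j)
      rw [Int.abs_eq_natAbs]
      omega
    · intro j
      have := Finset.single_le_sum (f := fun j => (p j).natAbs) (fun _ _ => Nat.zero_le _)
        (Finset.mem_univ j)
      rw [Int.abs_eq_natAbs]
      omega
    · intro i j
      have h1 := Finset.single_le_sum (f := fun j => (w i j).natAbs) (fun _ _ => Nat.zero_le _)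
        (Finset.mem_univ j)
      have h2 := Finset.single_le_sum (f := fun i => ∑ j, (w i j).natAbs)
        (fun _ _ => Nat.zero_le _) (Finset.mem_univ i)
      rw [Int.abs_eq_natAbs]
      omega
  refine ⟨2 * (k * L * L + k * L) + 1, 2 * (L + L * (L + 1)), by omega, ?_⟩
  intro n hn
  set T := n / (2 * (k * L * L + k * L) + 1) with hT
  have hTn : T * (2 * (k * L * L + k * L) + 1) ≤ n := Nat.div_mul_le_self _ _
  let g : (Fin k → ℕ) → (Fin m → ℤ) := fun t =>
    x0 + ((k * L * T + L + 1 : ℕ) : ℤ) • p + ∑ i, (t i : ℤ) • w i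
  have hcard : (Fintype.piFinset (fun _ : Fin k => Finset.range T)).card = T ^ k := by simp
  rw [← hcard]
  refine Finset.card_le_card_of_injOn g ?_ ?_
  · intro t ht
    have ht' : ∀ i, t i < T := by simpa using ht
    rw [Finset.mem_coe, mem_solF]
    constructor
    · intro j
      have hsum : |∑ i, (t i : ℤ) * w i j| ≤ k * L * T := by
        calc |∑ i, (t i : ℤ) * w i j| ≤ ∑ i, |(t i : ℤ) * w i j| :=
              Finset.abs_sum_le_sum_abs _ _
          _ ≤ ∑ i : Fin k, (T : ℤ) * L := by
              refine Finset.sum_le_sum fun i _ => ?_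
              rw [abs_mul]
              have := (ht' i).le
              refine mul_le_mul ?_ (hLw i j) (abs_nonneg _) (by positivity)
              simpa using this
          _ = k * L * T := by simp; ring
      have hg : g t j = x0 j + (k * L * T + L + 1) * p j + ∑ i, (t i : ℤ) * w i j := by
        simp [g, Finset.sum_apply]
      rw [hg]
      have h1 := abs_le.1 hsum
      have h2 := abs_le.1 (hLx j)
      have h3 := abs_le.1 (hLp j)
      have h4 := hp0 j
      have hq : (0:ℤ) ≤ k * L * T + L + 1 := by positivity
      have h5 : (k * L * T + L + 1 : ℤ) * 1 ≤ (k * L * T + L + 1) * p j :=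
        mul_le_mul_of_nonneg_left (by omega) hq
      have h6 : (k * L * T + L + 1 : ℤ) * p j ≤ (k * L * T + L + 1) * L :=
        mul_le_mul_of_nonneg_left h3.2 hq
      have hTn' : (T:ℤ) * (2 * (k * L * L + k * L) + 1) ≤ n := by exact_mod_cast hTn
      have hn' : (2:ℤ) * (L + L * (L + 1)) ≤ n := by exact_mod_cast hn
      have hT0 : (0:ℤ) ≤ T := by positivity
      constructor
      · linarith [h1.1, h2.1]
      · nlinarith [h1.2, h2.2]
    · simp only [g, Matrix.mulVec_add, Matrix.mulVec_smul, hp, hx0, Matrix.mulVec_sum, hw]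
      simp
  · intro t _ s _ hts
    have h0 : ∑ i, (t i : ℤ) • w i = ∑ i, (s i : ℤ) • w i := add_left_cancel hts
    have h1 : ∑ i, ((t i : ℚ) - s i) • cst (w i) = 0 := by
      funext j
      have h2 := congrFun h0 j
      simp only [Finset.sum_apply, Pi.smul_apply, smul_eq_mul] at h2
      have h3 : ∑ i, (t i : ℚ) * w i j = ∑ i, (s i : ℚ) * w i j := by exact_mod_cast h2
      simp [Finset.sum_apply, cst, sub_mul, Finset.sum_sub_distrib, h3]
    have h4 := Fintype.linearIndependent_iff.1 hli _ h1
    funext i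
    have := h4 i
    have h5 : (t i : ℚ) = s i := by linarith
    exact_mod_cast h5

/-- Proper solutions in the box. -/
noncomputable def propF {r m : ℕ} (A : Matrix (Fin r) (Fin m) ℤ) (b : Fin r → ℤ) (n : ℕ) :
    Finset (Fin m → ℤ) :=
  (solF A b n).filter (fun x => Function.Injective x)

theorem prop_lower {r m : ℕ} (A : Matrix (Fin r) (Fin m) ℤ) (hApos : IsPositiveMat A)
    (b : Fin r → ℤ) (hb : ∃ x : Fin m → ℤ, A.mulVec x = b)
    (hk : 0 < Module.finrank ℚ (kerQ A)) :
    ∃ c : ℝ, 0 < c ∧ ∃ n₀ : ℕ, ∀ n ≥ n₀,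
      c * (n : ℝ) ^ (Module.finrank ℚ (kerQ A)) ≤ (propF A b n).card := by
  obtain ⟨D, n₀, hD, h⟩ := sol_lower A hApos b hb
  obtain ⟨k, hk'⟩ : ∃ k, Module.finrank ℚ (kerQ A) = k + 1 := ⟨_, (Nat.succ_pred_eq_of_pos hk).symm⟩
  have hDr : (0:ℝ) < D := by exact_mod_cast hD
  set c : ℝ := (1 / (2 * D)) ^ (k + 1) with hc
  have hc0 : 0 < c := by positivity
  refine ⟨c / 2, by positivity, max (max n₀ (2 * D)) ⌈2 * (m:ℝ) ^ 2 / c⌉₊ + 1, ?_⟩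
  intro n hn
  have hn1 : n₀ ≤ n := by omega
  have hn2 : 2 * D ≤ n := by omega
  have hn3 : ⌈2 * (m:ℝ) ^ 2 / c⌉₊ ≤ n := by omega
  have hn4 : 1 ≤ n := by omega
  have hn5 : 2 * (m:ℝ) ^ 2 ≤ c * n := by
    have := Nat.ceil_le.1 hn3
    rw [div_le_iff₀ hc0] at this
    linarith
  have hbad : solF A b n ⊆ propF A b n ∪ (Finset.univ : Finset (Fin m × Fin m)).biUnion
      (fun ij => (solF A b n).filter (fun x => ij.1 ≠ ij.2 ∧ x ij.1 = x ij.2)) := by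
    intro x hx
    by_cases hi : Function.Injective x
    · exact Finset.mem_union_left _ (Finset.mem_filter.2 ⟨hx, hi⟩)
    · refine Finset.mem_union_right _ ?_
      simp only [Function.Injective] at hi
      push Not at hi
      obtain ⟨i, j, h1, h2⟩ := hi
      exact Finset.mem_biUnion.2 ⟨(i, j), Finset.mem_univ _, Finset.mem_filter.2 ⟨hx, h2, h1⟩⟩
  have hbc : ((Finset.univ : Finset (Fin m × Fin m)).biUnion
      (fun ij => (solF A b n).filter (fun x => ij.1 ≠ ij.2 ∧ x ij.1 = x ij.2))).card
      ≤ (Finset.univ : Finset (Fin m × Fin m)).card * n ^ k := by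
    refine Finset.card_biUnion_le_card_mul _ _ _ ?_
    rintro ⟨i, j⟩ -
    by_cases hij : i = j
    · simp [hij]
    · obtain ⟨v, hv, hvij⟩ := hApos.2 i j hij
      have := restricted_count hn4 A b
        (LinearMap.proj (R := ℚ) (φ := fun _ => ℚ) i - LinearMap.proj (R := ℚ) (φ := fun _ => ℚ) j)
        v hv ?_
        ((solF A b n).filter (fun x => i ≠ j ∧ x i = x j)) (Finset.filter_subset _ _) ?_
      · simpa [hk'] using this
      · simp only [LinearMap.sub_apply, LinearMap.proj_apply, cst]
        rw [sub_ne_zero]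
        exact_mod_cast hvij
      · intro x hx y hy
        rw [Finset.mem_filter] at hx hy
        simp [cst, hx.2.2, hy.2.2]
  have hall := (h n hn1).trans ((Finset.card_le_card hbad).trans (Finset.card_union_le _ _))
  rw [hk'] at hall ⊢
  have hall2 : (n / D) ^ (k + 1) ≤ (propF A b n).card + m ^ 2 * n ^ k := by
    have h6 : (Finset.univ : Finset (Fin m × Fin m)).card = m ^ 2 := by simp [sq]
    rw [h6] at hbc
    omega
  have hall3 : ((n / D : ℕ) : ℝ) ^ (k + 1) ≤ (propF A b n).card + (m:ℝ) ^ 2 * (n:ℝ) ^ k := by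
    exact_mod_cast hall2
  have hdiv : (1 / (2 * D)) * (n:ℝ) ≤ ((n / D : ℕ) : ℝ) := by
    have h7 : n < (n / D + 1) * D := by
      have := Nat.lt_mul_div_succ n hD
      rwa [mul_comm] at this
    have h8 : (n:ℝ) < ((n / D : ℕ) + 1) * D := by exact_mod_cast h7
    have h9 : (2:ℝ) * D ≤ n := by exact_mod_cast hn2
    rw [one_div, inv_mul_le_iff₀ (by positivity)]
    linarith
  have hpow : c * (n:ℝ) ^ (k + 1) ≤ ((n / D : ℕ) : ℝ) ^ (k + 1) := by
    rw [hc, ← mul_pow]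
    exact pow_le_pow_left₀ (by positivity) hdiv _
  have hlast : 2 * (m:ℝ) ^ 2 * (n:ℝ) ^ k ≤ c * n * (n:ℝ) ^ k :=
    mul_le_mul_of_nonneg_right hn5 (by positivity)
  have : c * n * (n:ℝ) ^ k = c * (n:ℝ) ^ (k + 1) := by ring
  linarith

/-- Intersecting ordered pairs. -/
noncomputable def pairF {r m : ℕ} (A : Matrix (Fin r) (Fin m) ℤ) (b : Fin r → ℤ) (n : ℕ) :
    Finset ((Fin m → ℤ) × (Fin m → ℤ)) :=
  (propF A b n ×ˢ propF A b n).filter (fun xy => ∃ j j', xy.1 j = xy.2 j')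

theorem pair_upper {r m n : ℕ} (hn : 1 ≤ n) (A : Matrix (Fin r) (Fin m) ℤ)
    (hApos : IsPositiveMat A) (b : Fin r → ℤ) :
    (pairF A b n).card ≤ m ^ 2 * (n ^ (Module.finrank ℚ (kerQ A)) *
      n ^ (Module.finrank ℚ (kerQ A) - 1)) := by
  obtain ⟨⟨p, hp, hp0⟩, -⟩ := hApos
  have hsub : pairF A b n ⊆ (Finset.univ : Finset (Fin m × Fin m)).biUnion (fun ij =>
      (solF A b n).biUnion fun x => ((solF A b n).filter (fun y => x ij.1 = y ij.2)).image
        (fun y => (x, y))) := by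
    rintro ⟨x, y⟩ hxy
    simp only [pairF, propF, Finset.mem_filter, Finset.mem_product] at hxy
    obtain ⟨⟨hx, hy⟩, j, j', hjj⟩ := hxy
    simp only [Finset.mem_biUnion, Finset.mem_image, Finset.mem_filter]
    exact ⟨(j, j'), Finset.mem_univ _, x, hx.1, y, ⟨hy.1, hjj⟩, rfl⟩
  have hsol : (solF A b n).card ≤ n ^ (Module.finrank ℚ (kerQ A)) := by
    refine box_count hn _ (kerQ A) le_rfl _ ?_ ?_
    · intro x hx; exact ((mem_solF A b n x).1 hx).1
    · intro x hx y hy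
      exact sub_mem_kerQ A b ((mem_solF A b n x).1 hx).2 ((mem_solF A b n y).1 hy).2
  have h6 : (Finset.univ : Finset (Fin m × Fin m)).card = m ^ 2 := by simp [sq]
  rw [← h6]
  refine (Finset.card_le_card hsub).trans (Finset.card_biUnion_le_card_mul _ _ _ ?_)
  rintro ⟨i, j⟩ -
  refine le_trans (Finset.card_biUnion_le_card_mul _ _ (n ^ (Module.finrank ℚ (kerQ A) - 1)) ?_)
    (Nat.mul_le_mul_right _ hsol)
  intro x _
  refine Finset.card_image_le.trans ?_
  refine restricted_count hn A b (LinearMap.proj (R := ℚ) (φ := fun _ => ℚ) j) p hp ?_ _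
    (Finset.filter_subset _ _) ?_
  · have := (hp0 j).ne'
    simpa [cst] using this
  · intro y hy z hz
    rw [Finset.mem_filter] at hy hz
    simp [cst, ← hy.2, ← hz.2]

theorem pair_lower {r m n : ℕ} (j : Fin m) (A : Matrix (Fin r) (Fin m) ℤ) (b : Fin r → ℤ) :
    (propF A b n).card ^ 2 ≤ n * (pairF A b n).card := by
  have hmaps : ∀ x ∈ propF A b n, x j ∈ Finset.Icc (1:ℤ) n := by
    intro x hx
    exact Finset.mem_Icc.2 (((mem_solF A b n x).1 (Finset.mem_filter.1 hx).1).1 j)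
  have h1 := Finset.card_eq_sum_card_fiberwise hmaps
  have h2 : ∑ a ∈ Finset.Icc (1:ℤ) n, ((propF A b n).filter (fun x => x j = a)).card ^ 2
      ≤ (pairF A b n).card := by
    have h3 : ∀ a ∈ Finset.Icc (1:ℤ) n, ((propF A b n).filter (fun x => x j = a)).card ^ 2 =
        (((propF A b n).filter (fun x => x j = a)) ×ˢ
          ((propF A b n).filter (fun x => x j = a))).card := by
      intro a _
      rw [Finset.card_product, sq]
    rw [Finset.sum_congr rfl h3, ← Finset.card_biUnion]
    · refine Finset.card_le_card ?_
      rintro ⟨x, y⟩ hxy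
      simp only [Finset.mem_biUnion, Finset.mem_product, Finset.mem_filter] at hxy
      obtain ⟨a, _, ⟨hx, hxa⟩, hy, hya⟩ := hxy
      simp only [pairF, Finset.mem_filter, Finset.mem_product]
      exact ⟨⟨hx, hy⟩, j, j, hxa.trans hya.symm⟩
    · intro a _ a' _ haa
      rw [Function.onFun, Finset.disjoint_left]
      rintro ⟨x, y⟩ hx hx'
      simp only [Finset.mem_product, Finset.mem_filter] at hx hx'
      exact haa (hx.1.2.symm.trans hx'.1.2)
  have h4 := sq_sum_le_card_mul_sum_sq (s := Finset.Icc (1:ℤ) n)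
    (f := fun a => ((propF A b n).filter (fun x => x j = a)).card)
  rw [h1]
  refine h4.trans ?_
  simpa using Nat.mul_le_mul_left n h2

/-- **Lemma (number of intersecting ordered pairs of proper solutions).** -/
theorem intersecting_pairs_count {r m : ℕ} (hr : 0 < r) (hrm : r < m)
    (A : Matrix (Fin r) (Fin m) ℤ) (hApos : IsPositiveMat A) (hAab : IsAbundantMat A)
    (b : Fin r → ℤ) (hb : ∃ x : Fin m → ℤ, A.mulVec x = b) :
    ∃ c C : ℝ, 0 < c ∧ 0 < C ∧ ∃ n₀ : ℕ, ∀ n ≥ n₀,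
      c * (n : ℝ) ^ (2 * m - 2 * rkZ A - 1) ≤
        (Nat.card {xy : (Fin m → ℤ) × (Fin m → ℤ) //
          A.mulVec xy.1 = b ∧ Function.Injective xy.1 ∧ (∀ j, 1 ≤ xy.1 j ∧ xy.1 j ≤ n) ∧
          A.mulVec xy.2 = b ∧ Function.Injective xy.2 ∧ (∀ j, 1 ≤ xy.2 j ∧ xy.2 j ≤ n) ∧
          ∃ j j', xy.1 j = xy.2 j'} : ℝ) ∧
      (Nat.card {xy : (Fin m → ℤ) × (Fin m → ℤ) //
          A.mulVec xy.1 = b ∧ Function.Injective xy.1 ∧ (∀ j, 1 ≤ xy.1 j ∧ xy.1 j ≤ n) ∧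
          A.mulVec xy.2 = b ∧ Function.Injective xy.2 ∧ (∀ j, 1 ≤ xy.2 j ∧ xy.2 j ≤ n) ∧
          ∃ j j', xy.1 j = xy.2 j'} : ℝ) ≤
        C * (n : ℝ) ^ (2 * m - 2 * rkZ A - 1) := by
  have hfin := finrank_kerQ A
  have hrk : rkZ A ≤ r := by
    have := Matrix.rank_le_card_height (A.map (Int.cast : ℤ → ℚ))
    simpa [rkZ] using this
  obtain ⟨k, hk⟩ : ∃ k, Module.finrank ℚ (kerQ A) = k + 1 :=
    ⟨Module.finrank ℚ (kerQ A) - 1, by omega⟩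
  have hexp : 2 * m - 2 * rkZ A - 1 = (k + 1) + k := by omega
  have hcard : ∀ n : ℕ, Nat.card {xy : (Fin m → ℤ) × (Fin m → ℤ) //
          A.mulVec xy.1 = b ∧ Function.Injective xy.1 ∧ (∀ j, 1 ≤ xy.1 j ∧ xy.1 j ≤ n) ∧
          A.mulVec xy.2 = b ∧ Function.Injective xy.2 ∧ (∀ j, 1 ≤ xy.2 j ∧ xy.2 j ≤ n) ∧
          ∃ j j', xy.1 j = xy.2 j'} = (pairF A b n).card := by
    intro n
    refine Nat.subtype_card _ ?_
    intro xy
    simp only [pairF, propF, Finset.mem_filter, Finset.mem_product, mem_solF]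
    tauto
  obtain ⟨c, hc, n₀, hlow⟩ := prop_lower A hApos b hb (by omega)
  refine ⟨c ^ 2, (m:ℝ) ^ 2, by positivity, ?_, n₀ + 1, ?_⟩
  · have : (0:ℝ) < m := by exact_mod_cast (by omega : 0 < m)
    positivity
  intro n hn
  rw [hcard n, hexp]
  have hn1 : 1 ≤ n := by omega
  have hnr : (0:ℝ) < n := by exact_mod_cast hn1
  constructor
  · have h1 := hlow n (by omega)
    have h2 : ((propF A b n).card : ℝ) ^ 2 ≤ n * (pairF A b n).card := by
      exact_mod_cast pair_lower (n := n) ⟨0, by omega⟩ A b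
    rw [hk] at h1
    have h3 := pow_le_pow_left₀ (by positivity) h1 2
    have h4 : (n:ℝ) * (c ^ 2 * (n:ℝ) ^ (k + 1 + k)) = (c * (n:ℝ) ^ (k + 1)) ^ 2 := by ring
    exact le_of_mul_le_mul_left (by linarith) hnr
  · have h1 := pair_upper hn1 A hApos b
    rw [hk] at h1
    simp only [Nat.add_sub_cancel, ← pow_add] at h1
    exact_mod_cast h1
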